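/- Let K be a convex body in R^n with cotype-2 constant C_2(X_K), and let μ be a finite, compactly supported isotropic Borel measure on R^n. Then (1/C_2(X_K)) · (∫ ‖x‖_K² dμ(x))^{1/2} ≤ √n · M_2(K), where M_2(K)² = ∫_{S^{n-1}} ‖θ‖_K² dσ(θ). -/

import Mathlib

open MeasureTheory ProbabilityTheory
open scoped RealInnerProductSpace

noncomputable section

/-- The Haar probability measure on the unit sphere of `EuclideanSpace ℝ (Fin n)`. -/
def sphereProb (n : ℕ) : Measure (Metric.sphere (0 : EuclideanSpace ℝ (Fin n)) 1) :=
  ((volume : Measure (EuclideanSpace ℝ (Fin n))).toSphere Set.univ)⁻¹ •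
    (volume : Measure (EuclideanSpace ℝ (Fin n))).toSphere

theorem sum_extend_zero_smul {ι κ V : Type*} [Fintype ι] [Fintype κ] [AddCommGroup V] [Module ℝ V]
    (e : ι ↪ κ) (w : ι → ℝ) (u : κ → V) :
    ∑ j, Function.extend e w 0 j • u j = ∑ i, w i • u (e i) := by
  rw [← Finset.sum_subset (Finset.subset_univ (Finset.univ.map e)), Finset.sum_map]
  · simp [e.injective.extend_apply]
  · intro j _ hj
    rw [Function.extend_apply' _ _ _ (by simpa using hj)]
    simp

theorem isCompact_convexHull_of_finiteDimensional {E : Type*} [AddCommGroup E] [Module ℝ E]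
    [TopologicalSpace E] [ContinuousAdd E] [ContinuousSMul ℝ E] [FiniteDimensional ℝ E]
    {s : Set E} (hs : IsCompact s) : IsCompact (convexHull ℝ s) := by
  classical
  let k := Module.finrank ℝ E + 1
  let Φ : (Fin k → ℝ) × (Fin k → E) → E := fun p => ∑ i, p.1 i • p.2 i
  have hΦ : Continuous Φ := by fun_prop
  suffices h : convexHull ℝ s = Φ '' (stdSimplex ℝ (Fin k) ×ˢ Set.univ.pi fun _ => s) by
    rw [h]
    exact ((isCompact_stdSimplex ℝ (Fin k)).prod (isCompact_univ_pi fun _ => hs)).image hΦ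
  refine Set.Subset.antisymm (fun x hx => ?_) ?_
  · obtain ⟨ι, _, z, w, hz, hind, hw, hw1, rfl⟩ := eq_pos_convex_span_of_mem_convexHull hx
    have hcard : Fintype.card ι ≤ Fintype.card (Fin k) := by
      rw [Fintype.card_fin]
      exact hind.card_le_finrank_succ.trans (Nat.add_le_add_right (Submodule.finrank_le _) 1)
    obtain ⟨e⟩ := Function.Embedding.nonempty_of_card_le hcard
    have : Nonempty ι := by
      by_contra hne
      rw [not_nonempty_iff] at hne
      simp at hw1
    obtain ⟨i₀⟩ := this
    refine ⟨(Function.extend e w 0, Function.extend e z fun _ => z i₀), ⟨⟨fun j => ?_, ?_⟩, ?_⟩, ?_⟩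
    · by_cases hj : ∃ i, e i = j
      · obtain ⟨i, rfl⟩ := hj
        simpa [e.injective.extend_apply] using (hw i).le
      · simp [Function.extend_apply' _ _ _ hj]
    · simpa [hw1] using sum_extend_zero_smul e w fun _ => (1 : ℝ)
    · intro j _
      by_cases hj : ∃ i, e i = j
      · obtain ⟨i, rfl⟩ := hj
        simpa [e.injective.extend_apply] using hz ⟨i, rfl⟩
      · simpa [Function.extend_apply' _ _ _ hj] using hz ⟨i₀, rfl⟩
    · simp [Φ, sum_extend_zero_smul, e.injective.extend_apply]
  · rintro _ ⟨⟨w, z⟩, ⟨hw, hz⟩, rfl⟩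
    exact (convex_convexHull ℝ s).sum_mem (fun i _ => hw.1 i) hw.2
      fun i _ => subset_convexHull ℝ s (hz i trivial)

/-- A cubature formula: the integral of a finite-dimensional continuous map against a finite,
compactly supported measure is a finite nonnegative combination of values of the map. -/
theorem exists_integral_eq_sum_smul {X V : Type*} [TopologicalSpace X] [T2Space X]
    [MeasurableSpace X] [BorelSpace X] [NormedAddCommGroup V] [NormedSpace ℝ V]
    [FiniteDimensional ℝ V] (μ : Measure X) [IsFiniteMeasure μ] {C : Set X} (hC : IsCompact C)
    (hμC : μ Cᶜ = 0) {F : X → V} (hF : Continuous F) :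
    Integrable F μ ∧ ∃ (m : ℕ) (w : Fin m → ℝ) (x : Fin m → X), (∀ i, 0 ≤ w i) ∧
      ∫ y, F y ∂μ = ∑ i, w i • F (x i) := by
  have hae : ∀ᵐ y ∂μ, y ∈ C := by rwa [ae_iff]
  have hint : Integrable F μ := by
    have := hF.continuousOn.integrableOn_compact (μ := μ) hC
    rwa [IntegrableOn, Measure.restrict_eq_self_of_ae_mem hae] at this
  refine ⟨hint, ?_⟩
  rcases eq_or_ne μ 0 with rfl | hμ
  · exact ⟨0, Fin.elim0, Fin.elim0, fun i => i.elim0, by simp⟩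
  have : NeZero μ := ⟨hμ⟩
  have hmem : (⨍ y, F y ∂μ) ∈ convexHull ℝ (F '' C) :=
    (convex_convexHull ℝ _).average_mem
      (isCompact_convexHull_of_finiteDimensional (hC.image hF)).isClosed
      (hae.mono fun y hy => subset_convexHull ℝ _ ⟨y, hy, rfl⟩) hint
  obtain ⟨ι, _, w, z, hw, -, hz, hsum⟩ := mem_convexHull_iff_exists_fintype.1 hmem
  choose x _ hx using hz
  let e := (Fintype.equivFin ι).symm
  refine ⟨Fintype.card ι, fun i => μ.real Set.univ * w (e i), fun i => x (e i),
    fun i => mul_nonneg measureReal_nonneg (hw _), ?_⟩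
  rw [← measure_smul_average, ← hsum, Finset.smul_sum, ← e.sum_comp]
  simp [hx, mul_smul]

/-- A simultaneous cubature formula for two continuous maps. -/
theorem exists_integral_eq_sum_smul_and_integral_eq_sum_smul {X V W : Type*} [TopologicalSpace X]
    [T2Space X] [MeasurableSpace X] [BorelSpace X] [NormedAddCommGroup V] [NormedSpace ℝ V]
    [FiniteDimensional ℝ V] [NormedAddCommGroup W] [NormedSpace ℝ W] [FiniteDimensional ℝ W]
    (μ : Measure X) [IsFiniteMeasure μ] {C : Set X} (hC : IsCompact C) (hμC : μ Cᶜ = 0)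
    {F : X → V} {G : X → W} (hF : Continuous F) (hG : Continuous G) :
    Integrable F μ ∧ Integrable G μ ∧
      ∃ (m : ℕ) (w : Fin m → ℝ) (x : Fin m → X), (∀ i, 0 ≤ w i) ∧
        ∫ y, F y ∂μ = ∑ i, w i • F (x i) ∧ ∫ y, G y ∂μ = ∑ i, w i • G (x i) := by
  obtain ⟨hint, m, w, x, hw, hsum⟩ := exists_integral_eq_sum_smul μ hC hμC (hF.prodMk hG)
  rw [integral_pair hint.fst hint.snd, Prod.ext_iff] at hsum
  exact ⟨hint.fst, hint.snd, m, w, x, hw, by simpa [Prod.fst_sum] using hsum.1,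
    by simpa [Prod.snd_sum] using hsum.2⟩

/-- A compactly supported isotropic measure can be replaced by a finitely supported isotropic one
without changing the integral of a given continuous function. -/
theorem exists_discrete_isotropic_integral_eq {E : Type*} [NormedAddCommGroup E]
    [InnerProductSpace ℝ E] [FiniteDimensional ℝ E] [MeasurableSpace E] [BorelSpace E]
    (μ : Measure E) [IsFiniteMeasure μ] {C : Set E} (hC : IsCompact C) (hμC : μ Cᶜ = 0)
    (hiso : ∀ θ : E, ∫ x, ⟪x, θ⟫ ^ 2 ∂μ = ‖θ‖ ^ 2) {q : E → ℝ} (hq : Continuous q) :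
    ∃ (m : ℕ) (w : Fin m → ℝ) (x : Fin m → E), (∀ i, 0 ≤ w i) ∧
      (∀ θ, ∑ i, w i * ⟪x i, θ⟫ ^ 2 = ‖θ‖ ^ 2) ∧ ∫ y, q y ∂μ = ∑ i, w i * q (x i) := by
  let F : E → E →L[ℝ] E →L[ℝ] ℝ :=
    fun x => ContinuousLinearMap.smulRightL ℝ _ _ (innerSL ℝ x) (innerSL ℝ x)
  have hF : Continuous F := by fun_prop
  obtain ⟨hint, -, m, w, x, hw, hsum, hqsum⟩ :=
    exists_integral_eq_sum_smul_and_integral_eq_sum_smul (V := E →L[ℝ] E →L[ℝ] ℝ) μ hC hμC hF hq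
  refine ⟨m, w, x, hw, fun θ => ?_, hqsum⟩
  let ℓ : (E →L[ℝ] E →L[ℝ] ℝ) →L[ℝ] ℝ :=
    ContinuousLinearMap.apply ℝ ℝ θ ∘L ContinuousLinearMap.apply ℝ (E →L[ℝ] ℝ) θ
  have hℓ : ∫ y, ℓ (F y) ∂μ = ∑ i, w i * ℓ (F (x i)) := by
    rw [ContinuousLinearMap.integral_comp_comm (𝕜 := ℝ) (E := E →L[ℝ] E →L[ℝ] ℝ) ℓ hint, hsum]
    simp
  rw [← hiso θ]
  simpa [F, ℓ, pow_two] using hℓ.symm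

section Gaussian

variable {E : Type*} [NormedAddCommGroup E] [InnerProductSpace ℝ E] [FiniteDimensional ℝ E]
  [MeasurableSpace E] [BorelSpace E]

theorem map_pi_gaussianReal_eq_stdGaussian {ι : Type*} [Fintype ι] (y : ι → E)
    (hy : ∀ θ : E, ∑ i, ⟪y i, θ⟫ ^ 2 = ‖θ‖ ^ 2) :
    (Measure.pi fun _ : ι => gaussianReal 0 1).map (fun g => ∑ i, g i • y i) = stdGaussian E := by
  apply Measure.ext_of_charFun
  ext t
  rw [charFun_stdGaussian, charFun_apply, integral_map (Measurable.aemeasurable (by fun_prop))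
    (Measurable.aestronglyMeasurable (by fun_prop))]
  simp_rw [sum_inner, Complex.ofReal_sum, Finset.sum_mul, Complex.exp_sum,
    integral_fintype_prod_eq_prod (f := fun i (x : ℝ) ↦ Complex.exp (⟪x • y i, t⟫ * Complex.I)),
    real_inner_smul_left, mul_comm _ (⟪_, _⟫), Complex.ofReal_mul, ← charFun_apply_real,
    charFun_gaussianReal]
  simp only [Complex.ofReal_zero, mul_zero, zero_mul, NNReal.coe_one, Complex.ofReal_one, one_mul,
    zero_sub]
  simp_rw [← Complex.exp_sum, Finset.sum_neg_distrib, ← Finset.sum_div, ← Complex.ofReal_pow,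
    ← Complex.ofReal_sum, hy, neg_div]

theorem integral_norm_sq_stdGaussian :
    ∫ x, ‖x‖ ^ 2 ∂(stdGaussian E) = Module.finrank ℝ E := by
  rw [stdGaussian_eq_map_pi_orthonormalBasis (stdOrthonormalBasis ℝ E),
    integral_map (Measurable.aemeasurable (by fun_prop))
      (Measurable.aestronglyMeasurable (by fun_prop))]
  have hsq : ∀ g : Fin (Module.finrank ℝ E) → ℝ,
      ‖∑ i, g i • stdOrthonormalBasis ℝ E i‖ ^ 2 = ∑ i, g i ^ 2 := fun g => by
    rw [← real_inner_self_eq_norm_sq, (stdOrthonormalBasis ℝ E).orthonormal.inner_sum]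
    simp [pow_two]
  have hone : ∫ x, x ^ 2 ∂(gaussianReal 0 1) = 1 := by
    have := variance_of_integral_eq_zero (μ := gaussianReal 0 1) (X := id) aemeasurable_id (by simp)
    simpa using this.symm
  simp_rw [hsq]
  rw [integral_finsetSum]
  · simp_rw [integral_comp_eval (μ := fun _ : Fin (Module.finrank ℝ E) => gaussianReal 0 1)
      (f := fun x : ℝ => x ^ 2) (by fun_prop), hone]
    simp
  · intro i _
    exact integrable_comp_eval (μ := fun _ : Fin (Module.finrank ℝ E) => gaussianReal 0 1)
      (f := fun x : ℝ => x ^ 2) (memLp_id_gaussianReal 2).integrable_sq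

theorem stdGaussian_eq_withDensity :
    stdGaussian E = (volume : Measure E).withDensity fun x => ENNReal.ofReal
      (((2 * Real.pi) ^ (Module.finrank ℝ E / 2 : ℝ))⁻¹ * Real.exp (-(1 / 2) * ‖x‖ ^ 2)) := by
  set c : ℝ := (2 * Real.pi) ^ (Module.finrank ℝ E / 2 : ℝ) with hc
  have hc0 : 0 < c := by positivity
  have hint : Integrable fun x : E => c⁻¹ * Real.exp (-(1 / 2) * ‖x‖ ^ 2) := by
    refine Integrable.const_mul (not_imp_comm.1 integral_undef ?_) _
    rw [GaussianFourier.integral_rexp_neg_mul_sq_norm (by norm_num)]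
    positivity
  have : IsFiniteMeasure ((volume : Measure E).withDensity fun x => ENNReal.ofReal
      (c⁻¹ * Real.exp (-(1 / 2) * ‖x‖ ^ 2))) := isFiniteMeasure_withDensity_ofReal hint.2
  apply Measure.ext_of_charFun
  ext t
  rw [charFun_stdGaussian, charFun_apply,
    integral_withDensity_eq_integral_toReal_smul (by fun_prop) (by simp)]
  have hcong : ∀ x : E, (ENNReal.ofReal (c⁻¹ * Real.exp (-(1 / 2) * ‖x‖ ^ 2))).toReal •
      Complex.exp (⟪x, t⟫ * Complex.I) =
      (c : ℂ)⁻¹ * Complex.exp (-(1 / 2) * ‖x‖ ^ 2 + Complex.I * ⟪t, x⟫) := fun x => by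
    rw [ENNReal.toReal_ofReal (by positivity), Complex.real_smul, Complex.exp_add,
      real_inner_comm]
    push_cast
    ring_nf
  simp_rw [hcong]
  rw [integral_const_mul, GaussianFourier.integral_cexp_neg_mul_sq_norm_add (by norm_num)]
  have hcc : (Real.pi / (1 / 2) : ℂ) ^ (Module.finrank ℝ E / 2 : ℂ) = c := by
    rw [hc, Complex.ofReal_cpow (by positivity)]
    push_cast
    congr 1
    ring
  rw [hcc, inv_mul_cancel_left₀ (by exact_mod_cast hc0.ne'), Complex.I_sq]
  congr 1
  ring

theorem integral_stdGaussian_eq_mul_integral_toSphere [Nontrivial E] :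
    ∃ A : ℝ, ∀ f : E → ℝ, (∀ r : ℝ, 0 < r → ∀ x, f (r • x) = r ^ 2 * f x) →
      ∫ x, f x ∂(stdGaussian E) =
        (∫ θ : Metric.sphere (0 : E) 1, f θ ∂(volume : Measure E).toSphere) * A := by
  set ρ : ℝ → ℝ := fun r =>
    ((2 * Real.pi) ^ (Module.finrank ℝ E / 2 : ℝ))⁻¹ * Real.exp (-(1 / 2) * r ^ 2) with hρ
  refine ⟨∫ r : Set.Ioi (0 : ℝ), ρ r * (r : ℝ) ^ 2
    ∂(Measure.volumeIoiPow (Module.finrank ℝ E - 1)), fun f hf => ?_⟩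
  rw [stdGaussian_eq_withDensity,
    integral_withDensity_eq_integral_toReal_smul (by fun_prop) (by simp)]
  have hρ0 : ∀ r, 0 ≤ ρ r := fun r => by positivity
  calc
    _ = ∫ x : E, ρ ‖x‖ * f x := by
      refine integral_congr_ae (.of_forall fun x => ?_)
      simp only [smul_eq_mul]
      rw [ENNReal.toReal_ofReal (hρ0 ‖x‖)]
    _ = ∫ x : ({(0)}ᶜ : Set E), ρ ‖x.1‖ * f x.1 ∂((volume : Measure E).comap (↑)) := by
      rw [integral_subtype_comap (measurableSet_singleton _).compl fun x => ρ ‖x‖ * f x,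
        restrict_compl_singleton]
    _ = ∫ p, f p.1 * (ρ p.2 * (p.2 : ℝ) ^ 2)
        ∂((volume : Measure E).toSphere.prod (.volumeIoiPow (Module.finrank ℝ E - 1))) := by
      rw [← (volume : Measure E).measurePreserving_homeomorphUnitSphereProd.integral_comp
        (Homeomorph.measurableEmbedding _)]
      refine integral_congr_ae (.of_forall fun x => ?_)
      have hx : 0 < ‖x.1‖ := norm_pos_iff.2 x.2
      simp only [homeomorphUnitSphereProd_apply_snd_coe, homeomorphUnitSphereProd_apply_fst_coe]
      rw [hf _ (inv_pos.2 hx)]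
      field_simp
    _ = _ := integral_prod_mul (fun θ : Metric.sphere (0 : E) 1 => f θ)
        (fun r : Set.Ioi (0 : ℝ) => ρ r * (r : ℝ) ^ 2)

/-- Polar integration of a function that is positively homogeneous of degree two against the
standard Gaussian measure. -/
theorem integral_stdGaussian_of_homogeneous [Nontrivial E] {f : E → ℝ}
    (hf : ∀ r : ℝ, 0 < r → ∀ x, f (r • x) = r ^ 2 * f x) :
    ∫ x, f x ∂(stdGaussian E) = Module.finrank ℝ E *
      (((volume : Measure E).toSphere.real Set.univ)⁻¹ *
        ∫ θ : Metric.sphere (0 : E) 1, f θ ∂(volume : Measure E).toSphere) := by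
  obtain ⟨A, hA⟩ := integral_stdGaussian_eq_mul_integral_toSphere (E := E)
  have hnorm := hA (fun x => ‖x‖ ^ 2) fun r hr x => by
    rw [norm_smul, mul_pow, Real.norm_eq_abs, sq_abs]
  have hpos : (volume : Measure E).toSphere.real Set.univ ≠ 0 := by
    rw [Ne, measureReal_eq_zero_iff, Measure.measure_univ_eq_zero]
    exact Measure.toSphere_ne_zero _
  rw [integral_norm_sq_stdGaussian] at hnorm
  simp only [norm_eq_of_mem_sphere, one_pow, integral_const, smul_eq_mul, mul_one] at hnorm
  rw [hA f hf, hnorm]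
  field_simp

end Gaussian

/-- Cotype-2 half of the isotropic measure proposition: if `X_K = (ℝⁿ, ‖·‖_K)` satisfies the
Gaussian cotype-2 inequality with constant `C₂` and `μ` is a finite, compactly supported
isotropic measure, then `(1/C₂) (∫ ‖x‖_K² dμ)^{1/2} ≤ √n · M₂(K)`. -/
theorem cotype2_le_sqrt_dim_mul_M2 {n : ℕ}
    (K : Set (EuclideanSpace ℝ (Fin n))) (hKconv : Convex ℝ K) (hKcompact : IsCompact K)
    (hKsymm : K = -K) (hK0 : (0 : EuclideanSpace ℝ (Fin n)) ∈ interior K)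
    (C₂ : ℝ) (hC₂ : 0 < C₂)
    (hcotype : ∀ (m : ℕ) (x : Fin m → EuclideanSpace ℝ (Fin n)),
      (1 / C₂ ^ 2) * ∑ i, gauge K (x i) ^ 2 ≤
        ∫ g : Fin m → ℝ, gauge K (∑ i, g i • x i) ^ 2
          ∂(Measure.pi fun _ : Fin m => gaussianReal 0 1))
    (μ : Measure (EuclideanSpace ℝ (Fin n))) [IsFiniteMeasure μ]
    (hsupp : ∃ C : Set (EuclideanSpace ℝ (Fin n)), IsCompact C ∧ μ Cᶜ = 0)
    (hiso : ∀ θ : EuclideanSpace ℝ (Fin n), ∫ x, ⟪x, θ⟫ ^ 2 ∂μ = ‖θ‖ ^ 2) :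
    (1 / C₂) * Real.sqrt (∫ x, gauge K x ^ 2 ∂μ) ≤
      Real.sqrt n * Real.sqrt (∫ θ : Metric.sphere (0 : EuclideanSpace ℝ (Fin n)) 1,
        gauge K (θ : EuclideanSpace ℝ (Fin n)) ^ 2 ∂(sphereProb n)) := by
  set γ : EuclideanSpace ℝ (Fin n) → ℝ := gauge K with hγ
  have hcont : Continuous γ := continuous_gauge hKconv (mem_interior_iff_mem_nhds.1 hK0)
  obtain ⟨C, hC, hμC⟩ := hsupp
  obtain ⟨m, w, x, hw, hquad, hgauge⟩ :=
    exists_discrete_isotropic_integral_eq μ hC hμC hiso (q := fun v => γ v ^ 2) (hcont.pow 2)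
  let y : Fin m → EuclideanSpace ℝ (Fin n) := fun i => Real.sqrt (w i) • x i
  have hhom : ∀ r : ℝ, 0 ≤ r → ∀ v, γ (r • v) ^ 2 = r ^ 2 * γ v ^ 2 := fun r hr v => by
    rw [hγ, gauge_smul_of_nonneg hr, smul_eq_mul, mul_pow]
  have hymap := map_pi_gaussianReal_eq_stdGaussian y fun θ => by
    simp_rw [← hquad θ, y, real_inner_smul_left, mul_pow, Real.sq_sqrt (hw _)]
  have hkey : (1 / C₂ ^ 2) * ∫ v, γ v ^ 2 ∂μ ≤
      ∫ v, γ v ^ 2 ∂(stdGaussian (EuclideanSpace ℝ (Fin n))) := by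
    rw [← hymap, integral_map (Measurable.aemeasurable (by fun_prop))
      (f := fun v => γ v ^ 2) (hcont.pow 2).aestronglyMeasurable, hgauge]
    convert hcotype m y using 3 with i
    rw [hhom _ (Real.sqrt_nonneg _), Real.sq_sqrt (hw i)]
  have hpolar : ∫ v, γ v ^ 2 ∂(stdGaussian (EuclideanSpace ℝ (Fin n))) =
      n * ∫ θ : Metric.sphere (0 : EuclideanSpace ℝ (Fin n)) 1, γ θ ^ 2 ∂(sphereProb n) := by
    rcases Nat.eq_zero_or_pos n with rfl | hn
    · simp [hγ, Subsingleton.elim _ (0 : EuclideanSpace ℝ (Fin 0))]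
    · have : Nonempty (Fin n) := ⟨⟨0, hn⟩⟩
      rw [integral_stdGaussian_of_homogeneous fun r hr => hhom r hr.le, sphereProb,
        integral_smul_measure, ENNReal.toReal_inv]
      simp [Measure.real]
  rw [← Real.sqrt_mul (Nat.cast_nonneg n), ← hpolar]
  refine (le_of_eq ?_).trans (Real.sqrt_le_sqrt hkey)
  rw [Real.sqrt_mul (by positivity), Real.sqrt_div zero_le_one, Real.sqrt_one,
    Real.sqrt_sq hC₂.le]
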